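/- arXiv:1503.01069 — 2 statements merged into one kernel-verified Lean document; each statement's English description precedes it below -/
import Mathlib

section
/- Let Γ be a connected weighted graph on {1,…,N} (N ≥ 4) whose black edges carry fixed positive weights and whose only red edges are the edge {1,2} with weight −x and the edge {3,4} with weight −y. Let L_{12,34} denote the submatrix of the Laplacian L(Γ) obtained by deleting rows 1 and 2 and columns 3 and 4 (this submatrix does not involve x or y). Then Δ = −(det L_{12,34})². -/
open Finset
open scoped Classical

/-- The graph Laplacian of a weighted graph on `{1,…,N}`. -/
noncomputable def lapl {N : ℕ} (γ : Fin N → Fin N → ℝ) : Matrix (Fin N) (Fin N) ℝ :=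
  Matrix.of fun i j =>
    if i = j then -(∑ k ∈ univ.filter (fun k => k ≠ i), γ i k) else γ i j

/-- The simple graph on `Fin N` whose edges are the (ordered) pairs in `T`. -/
def edgeGraph {N : ℕ} (T : Finset (Fin N × Fin N)) : SimpleGraph (Fin N) :=
  SimpleGraph.fromRel fun a b => (a, b) ∈ T

/-- The product of the weights of the edges in `T`. -/
noncomputable def prodWeight {N : ℕ} (γ : Fin N → Fin N → ℝ)
    (T : Finset (Fin N × Fin N)) : ℝ :=
  ∏ p ∈ T, γ p.1 p.2

/-- The black edges: the (ordered) pairs carrying a nonzero (positive) weight. -/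
noncomputable def blackE {N : ℕ} (γ : Fin N → Fin N → ℝ) : Finset (Fin N × Fin N) :=
  univ.filter fun p => p.1 < p.2 ∧ γ p.1 p.2 ≠ 0

/-- The ordered pair representing the edge `{i, j}`. -/
def redPair {N : ℕ} (i j : Fin N) : Fin N × Fin N := (min i j, max i j)

/-- Spanning trees of the graph `Γ` whose edges are the black edges of `γ`
together with the two red edges `{i,j}` and `{k,l}`. -/
noncomputable def spTrees {N : ℕ} (γ : Fin N → Fin N → ℝ) (i j k l : Fin N) :
    Finset (Finset (Fin N × Fin N)) :=
  univ.filter fun T =>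
    T ⊆ blackE γ ∪ {redPair i j, redPair k l} ∧ (edgeGraph T).IsTree

/-- The coefficient `A_{b₁b₂}`: the sum, over all spanning trees of `Γ` whose
set of red edges is exactly the one prescribed by `(b₁, b₂)`, of the product of
the black edge weights of the tree. -/
noncomputable def coeffA {N : ℕ} (γ : Fin N → Fin N → ℝ) (i j k l : Fin N)
    (b1 b2 : Bool) : ℝ :=
  ∑ T ∈ (spTrees γ i j k l).filter
      (fun T => (redPair i j ∈ T ↔ b1 = true) ∧ (redPair k l ∈ T ↔ b2 = true)),
    prodWeight γ (T \ {redPair i j, redPair k l})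

/-- The discriminant `Δ = A₁₁A₀₀ − A₀₁A₁₀` of the crossing polynomial
`M(Γ) = A₁₁xy − A₁₀x − A₀₁y + A₀₀`. -/
noncomputable def crossDisc {N : ℕ} (γ : Fin N → Fin N → ℝ) (i j k l : Fin N) : ℝ :=
  coeffA γ i j k l true true * coeffA γ i j k l false false -
    coeffA γ i j k l false true * coeffA γ i j k l true false

/-- Spanning 2-forests of `Γ` in which each of the two components contains
exactly one vertex of `{i,j}` and exactly one vertex of `{k,l}` (such a forest
contains no red edge, hence consists of black edges). -/
noncomputable def twoForests {N : ℕ} (γ : Fin N → Fin N → ℝ) (i j k l : Fin N) :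
    Finset (Finset (Fin N × Fin N)) :=
  univ.filter fun F => F ⊆ blackE γ ∧ (edgeGraph F).IsAcyclic ∧
    Nat.card (edgeGraph F).ConnectedComponent = 2 ∧
    ¬ (edgeGraph F).Reachable i j ∧ ¬ (edgeGraph F).Reachable k l


/-- The parent function `f` flows to the root `0`, witnessed by a depth function. -/
def FlowsToRoot {m : ℕ} (f : Fin m → Fin (m + 1)) : Prop :=
  ∃ d : Fin (m + 1) → ℕ, d 0 = 0 ∧ ∀ i, d i.succ = d (f i) + 1

/-- The reduced Laplacian (vertex `0` deleted, positive sign convention). -/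
noncomputable def redLap {m : ℕ} (w : Fin (m + 1) → Fin (m + 1) → ℝ) : Matrix (Fin m) (Fin m) ℝ :=
  Matrix.of fun i j => (if i = j then ∑ k, w i.succ k else 0) - w i.succ j.succ

/-- The matrix `1 - P_f`. -/
noncomputable def funMat {m : ℕ} (f : Fin m → Fin (m + 1)) : Matrix (Fin m) (Fin m) ℝ :=
  1 - Matrix.of fun i j => if f i = j.succ then (1 : ℝ) else 0

lemma det_funMat_of_flows {m : ℕ} (f : Fin m → Fin (m + 1)) (h : FlowsToRoot f) :
    (funMat f).det = 1 := by
  obtain ⟨d, -, hd⟩ := h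
  set P : Matrix (Fin m) (Fin m) ℝ := Matrix.of fun i j => if f i = j.succ then (1 : ℝ) else 0
    with hP
  have key : ∀ k i j, d (Fin.succ i) ≤ k → (P ^ k) i j = 0 := by
    intro k
    induction k with
    | zero => intro i j h; have := hd i; omega
    | succ k ih =>
      intro i j h
      rw [pow_succ', Matrix.mul_apply]
      refine Finset.sum_eq_zero fun l _ => ?_
      by_cases hl : f i = l.succ
      · rw [ih l j, mul_zero]
        have := hd i
        rw [hl] at this
        omega
      · simp [hP, hl]
  have hnil : IsNilpotent P := by
    refine ⟨∑ v, d v, ?_⟩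
    ext i j
    exact key _ i j (Finset.single_le_sum (fun _ _ => Nat.zero_le _) (Finset.mem_univ _))
  have h1 := (Matrix.isNilpotent_charpoly_sub_pow_of_isNilpotent hnil).eq_zero
  have h2 := congrArg (Polynomial.eval 1) h1
  rw [Polynomial.eval_sub, Matrix.eval_charpoly] at h2
  simp at h2
  have : funMat f = 1 - P := rfl
  rw [this]
  linarith

lemma det_funMat_of_not_flows {m : ℕ} (f : Fin m → Fin (m + 1)) (h : ¬ FlowsToRoot f) :
    (funMat f).det = 0 := by
  set F : Fin (m + 1) → Fin (m + 1) := Fin.cons 0 f with hF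
  set R : Fin (m + 1) → Prop := fun v => ∃ k, F^[k] v = 0 with hR
  have hR0 : R 0 := ⟨0, rfl⟩
  have hRs : ∀ i : Fin m, R i.succ ↔ R (f i) := by
    intro i
    constructor
    · rintro ⟨k, hk⟩
      cases k with
      | zero => exact absurd hk (Fin.succ_ne_zero i)
      | succ k => exact ⟨k, by simpa [hF] using hk⟩
    · rintro ⟨k, hk⟩
      exact ⟨k + 1, by simpa [hF] using hk⟩
  have hnot : ¬ ∀ v, R v := by
    intro hall
    apply h
    refine ⟨fun v => Nat.find (hall v), ?_, ?_⟩
    · simp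
    · intro i
      have h2 : ∃ n, F^[n+1] i.succ = 0 := by
        obtain ⟨k, hk⟩ := hall (f i)
        exact ⟨k, by simpa [hF] using hk⟩
      change Nat.find (hall i.succ) = Nat.find (hall (f i)) + 1
      rw [Nat.find_comp_succ (hall i.succ) h2 (Fin.succ_ne_zero i)]
      congr 1
  rw [← Matrix.exists_mulVec_eq_zero_iff]
  refine ⟨fun j => if R j.succ then 0 else 1, ?_, ?_⟩
  · intro h0
    apply hnot
    intro v
    induction v using Fin.cases with
    | zero => exact hR0
    | succ i =>
      by_contra hc
      have := congrFun h0 i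
      simp [hc] at this
  · ext i
    rw [funMat, Matrix.sub_mulVec, Matrix.one_mulVec]
    simp only [Pi.sub_apply, Matrix.mulVec, dotProduct, Matrix.of_apply, Pi.zero_apply, hRs i]
    generalize f i = v
    induction v using Fin.cases with
    | zero =>
      rw [if_pos hR0, Finset.sum_eq_zero]
      · simp
      · intro l _
        simp [(Fin.succ_ne_zero l).symm]
    | succ l =>
      rw [Finset.sum_eq_single l]
      · simp
      · intro b _ hb
        simp [Fin.succ_inj, hb.symm]
      · simp

lemma det_redLap {m : ℕ} (w : Fin (m + 1) → Fin (m + 1) → ℝ) :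
    (redLap w).det = ∑ f ∈ univ.filter (fun f : Fin m → Fin (m + 1) => FlowsToRoot f),
      ∏ i, w i.succ (f i) := by
  have h1 : redLap w = fun i => ∑ k, w i.succ k •
      (fun j => (if i = j then (1 : ℝ) else 0) - if k = Fin.succ j then 1 else 0) := by
    ext i j
    simp [redLap, mul_sub, Finset.sum_sub_distrib]
  have h2 : (redLap w).det = ∑ f : Fin m → Fin (m + 1), (∏ i, w i.succ (f i)) * (funMat f).det := by
    rw [h1]
    change (Matrix.detRowAlternating (R := ℝ) (n := Fin m)).toMultilinearMap _ = _
    rw [MultilinearMap.map_sum]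
    refine Finset.sum_congr rfl fun f _ => ?_
    rw [MultilinearMap.map_smul_univ, smul_eq_mul]
    congr 1
  rw [h2, Finset.sum_filter]
  refine Finset.sum_congr rfl fun f _ => ?_
  split_ifs with h
  · rw [det_funMat_of_flows f h, mul_one]
  · rw [det_funMat_of_not_flows f h, mul_zero]

/-- The edge set of the graph of the parent function `f`. -/
noncomputable def funEdges {m : ℕ} (f : Fin m → Fin (m + 1)) : Finset (Fin (m + 1) × Fin (m + 1)) :=
  univ.image fun i : Fin m => redPair i.succ (f i)

lemma edgeGraph_adj {N : ℕ} (T : Finset (Fin N × Fin N)) (hT : ∀ p ∈ T, p.1 < p.2) (a b : Fin N) :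
    (edgeGraph T).Adj a b ↔ a ≠ b ∧ redPair a b ∈ T := by
  rw [edgeGraph, SimpleGraph.fromRel_adj]
  refine and_congr_right fun hab => ?_
  rcases lt_or_gt_of_ne hab with h | h
  · rw [redPair, min_eq_left h.le, max_eq_right h.le]
    refine or_iff_left fun hc => ?_
    exact absurd (hT _ hc) (by simpa using h.le)
  · rw [redPair, min_eq_right h.le, max_eq_left h.le]
    refine or_iff_right fun hc => ?_
    exact absurd (hT _ hc) (by simpa using h.le)

lemma redPair_comm {N : ℕ} (a b : Fin N) : redPair a b = redPair b a := by
  simp [redPair, min_comm, max_comm]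

lemma redPair_of_lt {N : ℕ} {p : Fin N × Fin N} (h : p.1 < p.2) : redPair p.1 p.2 = p := by
  simp [redPair, min_eq_left h.le, max_eq_right h.le]

lemma redPair_eq {N : ℕ} {a b c d : Fin N} (h : redPair a b = redPair c d) :
    (a = c ∧ b = d) ∨ (a = d ∧ b = c) := by
  simp only [redPair, Prod.mk.injEq] at h
  grind

lemma redPair_lt {N : ℕ} {a b : Fin N} (h : a ≠ b) : (redPair a b).1 < (redPair a b).2 := by
  simpa [redPair] using h.symm

lemma card_edgeSet {N : ℕ} (T : Finset (Fin N × Fin N)) (hT : ∀ p ∈ T, p.1 < p.2) :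
    Nat.card (edgeGraph T).edgeSet = T.card := by
  have h : (edgeGraph T).edgeSet = ((T.image fun p => s(p.1, p.2) : Finset (Sym2 (Fin N))) :
      Set (Sym2 (Fin N))) := by
    ext e
    induction e using Sym2.ind with
    | _ a b =>
      rw [SimpleGraph.mem_edgeSet, edgeGraph_adj T hT, Finset.mem_coe, Finset.mem_image]
      constructor
      · rintro ⟨hab, hm⟩
        refine ⟨_, hm, ?_⟩
        rcases lt_or_gt_of_ne hab with h | h
        · simp [redPair, min_eq_left h.le, max_eq_right h.le]
        · simp [redPair, min_eq_right h.le, max_eq_left h.le]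
      · rintro ⟨p, hp, he⟩
        have hlt := hT p hp
        have h1 := redPair_of_lt hlt
        rcases Sym2.eq_iff.mp he with ⟨rfl, rfl⟩ | ⟨rfl, rfl⟩
        · exact ⟨hlt.ne, by rwa [h1]⟩
        · exact ⟨hlt.ne', by rwa [redPair_comm, h1]⟩
  rw [h, Nat.card_coe_set_eq, Set.ncard_coe_finset, Finset.card_image_of_injOn]
  intro p hp q hq hpq
  have h1 := hT p hp
  have h2 := hT q hq
  rcases Sym2.eq_iff.mp hpq with ⟨h, h'⟩ | ⟨h, h'⟩
  · exact Prod.ext h h'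
  · rw [h, h'] at h1
    exact absurd h1 h2.le.not_gt

lemma flows_ne {m : ℕ} {f : Fin m → Fin (m + 1)} (h : FlowsToRoot f) (i : Fin m) :
    i.succ ≠ f i := by
  obtain ⟨d, -, hd⟩ := h
  intro he
  have := hd i
  rw [← he] at this
  omega

lemma funEdges_lt {m : ℕ} {f : Fin m → Fin (m + 1)} (h : FlowsToRoot f) :
    ∀ p ∈ funEdges f, p.1 < p.2 := by
  intro p hp
  obtain ⟨i, -, rfl⟩ := Finset.mem_image.mp hp
  exact redPair_lt (flows_ne h i)

lemma funEdges_connected {m : ℕ} {f : Fin m → Fin (m + 1)} (h : FlowsToRoot f) :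
    (edgeGraph (funEdges f)).Connected := by
  have hadj : ∀ i, (edgeGraph (funEdges f)).Adj i.succ (f i) := fun i =>
    (edgeGraph_adj _ (funEdges_lt h) _ _).mpr
      ⟨flows_ne h i, Finset.mem_image_of_mem _ (Finset.mem_univ i)⟩
  obtain ⟨d, -, hd⟩ := h
  have key : ∀ k v, d v ≤ k → (edgeGraph (funEdges f)).Reachable v 0 := by
    intro k
    induction k with
    | zero =>
      intro v hv
      induction v using Fin.cases with
      | zero => exact SimpleGraph.Reachable.refl _
      | succ i => have := hd i; omega
    | succ k ih =>
      intro v hv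
      induction v using Fin.cases with
      | zero => exact SimpleGraph.Reachable.refl _
      | succ i => exact (hadj i).reachable.trans (ih _ (by have := hd i; omega))
  exact (SimpleGraph.connected_iff _).mpr
    ⟨fun a b => (key _ a le_rfl).trans (key _ b le_rfl).symm, ⟨0⟩⟩

lemma funEdges_card {m : ℕ} {f : Fin m → Fin (m + 1)} (h : FlowsToRoot f) :
    (funEdges f).card = m := by
  apply le_antisymm
  · exact Finset.card_image_le.trans (by simp)
  · have := (funEdges_connected h).card_vert_le_card_edgeSet_add_one
    rw [card_edgeSet _ (funEdges_lt h)] at this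
    simpa using this

lemma funEdges_isTree {m : ℕ} {f : Fin m → Fin (m + 1)} (h : FlowsToRoot f) :
    (edgeGraph (funEdges f)).IsTree := by
  rw [SimpleGraph.isTree_iff_connected_and_card]
  refine ⟨funEdges_connected h, ?_⟩
  rw [card_edgeSet _ (funEdges_lt h), funEdges_card h]
  simp

lemma prodWeight_funEdges {m : ℕ} (w : Fin (m + 1) → Fin (m + 1) → ℝ)
    (hw : ∀ a b, w a b = w b a) {f : Fin m → Fin (m + 1)} (h : FlowsToRoot f) :
    prodWeight w (funEdges f) = ∏ i, w i.succ (f i) := by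
  have hinj : Set.InjOn (fun i : Fin m => redPair i.succ (f i)) (univ : Finset (Fin m)) := by
    apply Finset.card_image_iff.mp
    exact (funEdges_card h).trans (by simp)
  rw [prodWeight, funEdges, Finset.prod_image hinj]
  refine Finset.prod_congr rfl fun i _ => ?_
  rcases le_total i.succ (f i) with h | h
  · simp [redPair, min_eq_left h, max_eq_right h]
  · simp [redPair, min_eq_right h, max_eq_left h, hw (f i)]

lemma depth_le {m : ℕ} {f g : Fin m → Fin (m + 1)} {d e : Fin (m + 1) → ℕ}
    (hd0 : d 0 = 0) (hd : ∀ i, d i.succ = d (f i) + 1)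
    (he : ∀ i, e i.succ = e (g i) + 1) (hsub : funEdges g ⊆ funEdges f) :
    ∀ k v, e v ≤ k → d v ≤ e v := by
  intro k
  induction k with
  | zero =>
    intro v hv
    induction v using Fin.cases with
    | zero => omega
    | succ i => have := he i; omega
  | succ k ih =>
    intro v hv
    induction v using Fin.cases with
    | zero => omega
    | succ i =>
      have h1 := he i
      have h2 := ih (g i) (by omega)
      obtain ⟨j, -, hj⟩ := Finset.mem_image.mp
        (hsub (Finset.mem_image_of_mem _ (Finset.mem_univ i)))
      have h3 := hd j
      rcases redPair_eq hj with ⟨ha, hb⟩ | ⟨ha, hb⟩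
      · rw [ha, hb] at h3; omega
      · rw [ha, hb] at h3; omega

lemma funEdges_inj {m : ℕ} {f g : Fin m → Fin (m + 1)} (hf : FlowsToRoot f) (hg : FlowsToRoot g)
    (h : funEdges f = funEdges g) : f = g := by
  obtain ⟨d, hd0, hd⟩ := hf
  obtain ⟨e, he0, he⟩ := hg
  have hde : ∀ v, d v = e v := fun v => le_antisymm
    (depth_le hd0 hd he h.ge _ v le_rfl) (depth_le he0 he hd h.le _ v le_rfl)
  funext i
  obtain ⟨j, -, hj⟩ := Finset.mem_image.mp
    (h.le (Finset.mem_image_of_mem (fun i : Fin m => redPair i.succ (f i)) (Finset.mem_univ i)))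
  rcases redPair_eq hj with ⟨ha, hb⟩ | ⟨ha, hb⟩
  · rw [← hb, Fin.succ_inj.mp ha]
  · have h1 := hd i
    have h2 := he j
    rw [ha, hb, ← hde, ← hde] at h2
    omega

lemma exists_parent {N : ℕ} [NeZero N] (G : SimpleGraph (Fin N)) (hG : G.Connected) (v : Fin N)
    (hv : v ≠ 0) : ∃ u, G.Adj v u ∧ G.dist v 0 = G.dist u 0 + 1 := by
  obtain ⟨p, hp⟩ := hG.exists_walk_length_eq_dist v 0
  cases p with
  | nil => exact absurd rfl hv
  | @cons _ u _ hadj q =>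
    refine ⟨u, hadj, ?_⟩
    have h1 : G.dist u 0 ≤ q.length := SimpleGraph.dist_le q
    have h2 : G.dist v 0 ≤ G.dist v u + G.dist u 0 := hG.dist_triangle
    rw [SimpleGraph.dist_eq_one_iff_adj.mpr hadj] at h2
    rw [SimpleGraph.Walk.length_cons] at hp
    omega

lemma funEdges_surj {m : ℕ} (T : Finset (Fin (m + 1) × Fin (m + 1))) (hT : ∀ p ∈ T, p.1 < p.2)
    (ht : (edgeGraph T).IsTree) : ∃ f : Fin m → Fin (m + 1), FlowsToRoot f ∧ funEdges f = T := by
  choose f hf1 hf2 using fun i : Fin m =>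
    exists_parent (edgeGraph T) ht.connected i.succ (Fin.succ_ne_zero i)
  have hfl : FlowsToRoot f := ⟨fun v => (edgeGraph T).dist v 0, by simp, hf2⟩
  refine ⟨f, hfl, Finset.eq_of_subset_of_card_le ?_ ?_⟩
  · intro p hp
    obtain ⟨i, -, rfl⟩ := Finset.mem_image.mp hp
    exact ((edgeGraph_adj T hT _ _).mp (hf1 i)).2
  · have := (SimpleGraph.isTree_iff_connected_and_card.mp ht).2
    rw [card_edgeSet T hT] at this
    rw [funEdges_card hfl]
    simp at this
    omega

/-- Trees on the vertex set `Fin N`, as sets of increasing pairs. -/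
noncomputable def allTrees (N : ℕ) : Finset (Finset (Fin N × Fin N)) :=
  univ.filter fun T => (∀ p ∈ T, p.1 < p.2) ∧ (edgeGraph T).IsTree

/-- The matrix-tree theorem. -/
lemma matrix_tree {m : ℕ} (w : Fin (m + 1) → Fin (m + 1) → ℝ) (hw : ∀ a b, w a b = w b a) :
    (redLap w).det = ∑ T ∈ allTrees (m + 1), prodWeight w T := by
  rw [det_redLap]
  refine Finset.sum_bij (fun f _ => funEdges f) ?_ ?_ ?_ ?_
  · intro f hf
    have h := (Finset.mem_filter.mp hf).2
    exact Finset.mem_filter.mpr ⟨Finset.mem_univ _, funEdges_lt h, funEdges_isTree h⟩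
  · intro f hf g hg h
    exact funEdges_inj (Finset.mem_filter.mp hf).2 (Finset.mem_filter.mp hg).2 h
  · intro T hT
    obtain ⟨-, h1, h2⟩ := Finset.mem_filter.mp hT
    obtain ⟨f, hf, he⟩ := funEdges_surj T h1 h2
    exact ⟨f, Finset.mem_filter.mpr ⟨Finset.mem_univ _, hf⟩, he⟩
  · intro f hf
    exact (prodWeight_funEdges w hw (Finset.mem_filter.mp hf).2).symm

lemma det_rank_two_of_unit {m : ℕ} (K : Matrix (Fin m) (Fin m) ℝ) (hK : K.det ≠ 0)
    (u v : Fin m → ℝ) :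
    (K + Matrix.vecMulVec u u + Matrix.vecMulVec v v).det * K.det
      - (K + Matrix.vecMulVec u u).det * (K + Matrix.vecMulVec v v).det
      = -((u ⬝ᵥ K.adjugate.mulVec v) * (v ⬝ᵥ K.adjugate.mulVec u)) := by
  have hu : IsUnit K.det := isUnit_iff_ne_zero.mpr hK
  have hadj : K.adjugate = K.det • K⁻¹ := by
    rw [Matrix.inv_def, smul_smul, Ring.inverse_eq_inv', mul_inv_cancel₀ hK, one_smul]
  have one : ∀ z : Fin m → ℝ, (K + Matrix.vecMulVec z z).det =
      K.det * (1 + z ⬝ᵥ K⁻¹.mulVec z) := by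
    intro z
    rw [Matrix.vecMulVec_eq Unit, Matrix.det_add_replicateCol_mul_replicateRow hu]
    simp [Matrix.mul_apply, Matrix.mulVec, dotProduct, Finset.sum_mul, Finset.mul_sum, mul_assoc]
    left
    exact Finset.sum_comm
  have two : (K + Matrix.vecMulVec u u + Matrix.vecMulVec v v).det =
      K.det * ((1 + u ⬝ᵥ K⁻¹.mulVec u) * (1 + v ⬝ᵥ K⁻¹.mulVec v)
        - (u ⬝ᵥ K⁻¹.mulVec v) * (v ⬝ᵥ K⁻¹.mulVec u)) := by
    have e : K + Matrix.vecMulVec u u + Matrix.vecMulVec v v =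
        K + (Matrix.of ![u, v]).transpose * Matrix.of ![u, v] := by
      rw [add_assoc]
      congr 1
      ext i j
      simp [Matrix.mul_apply, Matrix.vecMulVec_apply]
    have g : ∀ a b : Fin 2, (Matrix.of ![u, v] * K⁻¹ * (Matrix.of ![u, v]).transpose) a b =
        (![u, v] a) ⬝ᵥ K⁻¹.mulVec (![u, v] b) := by
      intro a b
      rw [Matrix.mul_assoc]
      rfl
    rw [e, Matrix.det_add_mul _ _ hu, Matrix.det_fin_two]
    simp only [Matrix.add_apply, g]
    simp
  rw [two, one u, one v, hadj]
  simp only [Matrix.smul_mulVec, dotProduct_smul, smul_eq_mul]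
  ring

lemma det_rank_two {m : ℕ} (K : Matrix (Fin m) (Fin m) ℝ) (u v : Fin m → ℝ) :
    (K + Matrix.vecMulVec u u + Matrix.vecMulVec v v).det * K.det
      - (K + Matrix.vecMulVec u u).det * (K + Matrix.vecMulVec v v).det
      = -((u ⬝ᵥ K.adjugate.mulVec v) * (v ⬝ᵥ K.adjugate.mulVec u)) := by
  set g : ℝ → Matrix (Fin m) (Fin m) ℝ := fun e => K + e • (1 : Matrix (Fin m) (Fin m) ℝ) with hg
  have hgc : Continuous g := by fun_prop
  have hdense : Dense {e : ℝ | (g e).det ≠ 0} := by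
    have hfin : {e : ℝ | (g e).det = 0}.Finite := by
      have hne : (-K).charpoly ≠ 0 := (Matrix.charpoly_monic _).ne_zero
      refine ((-K).charpoly.rootSet_finite ℝ).subset ?_
      intro e he
      rw [Polynomial.mem_rootSet]
      refine ⟨hne, ?_⟩
      have : (-K).charpoly.eval e = 0 := by
        rw [Matrix.eval_charpoly]
        rw [← he.out]
        congr 1
        simp only [hg, sub_neg_eq_add, Matrix.smul_one_eq_diagonal, add_comm]
        rfl
      simpa using this
    exact Set.Countable.dense_compl ℝ (Set.Finite.countable hfin)
  have hL : Continuous fun e : ℝ =>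
      (g e + Matrix.vecMulVec u u + Matrix.vecMulVec v v).det * (g e).det
      - (g e + Matrix.vecMulVec u u).det * (g e + Matrix.vecMulVec v v).det := by
    have h1 := (hgc.add (continuous_const (y := Matrix.vecMulVec u u)))
    have h2 := (hgc.add (continuous_const (y := Matrix.vecMulVec v v)))
    have h3 := (h1.add (continuous_const (y := Matrix.vecMulVec v v)))
    exact (h3.matrix_det.mul hgc.matrix_det).sub (h1.matrix_det.mul h2.matrix_det)
  have hR : Continuous fun e : ℝ =>
      -((u ⬝ᵥ (g e).adjugate.mulVec v) * (v ⬝ᵥ (g e).adjugate.mulVec u)) := by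
    have ha := hgc.matrix_adjugate
    exact ((continuous_const.dotProduct (ha.matrix_mulVec continuous_const)).mul
      (continuous_const.dotProduct (ha.matrix_mulVec continuous_const))).neg
  have := Continuous.ext_on hdense hL hR (fun e he => det_rank_two_of_unit (g e) he u v)
  have h0 := congrFun this 0
  simpa [hg] using h0

lemma redLap_transpose {m : ℕ} (w : Fin (m + 1) → Fin (m + 1) → ℝ) (hw : ∀ a b, w a b = w b a) :
    (redLap w).transpose = redLap w := by
  ext i j
  simp only [Matrix.transpose_apply, redLap, Matrix.of_apply]
  rw [hw j.succ i.succ]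
  by_cases h : i = j
  · simp [h]
  · simp [h, Ne.symm h]

lemma redLap_row_sum {m : ℕ} (w : Fin (m + 1) → Fin (m + 1) → ℝ) (i : Fin m) :
    ∑ j, redLap w i j = w i.succ 0 := by
  simp only [redLap, Matrix.of_apply, Finset.sum_sub_distrib]
  simp [Fin.sum_univ_succ]

/-- The minor obtained from the reduced Laplacian, up to sign. -/
lemma minor_sq {n : ℕ} (w : Fin (n + 4) → Fin (n + 4) → ℝ) (v : Fin (n + 3) → ℝ)
    (hv : v = Pi.single 1 1 - Pi.single 2 1)
    (Q : Matrix (Fin (n + 2)) (Fin (n + 2)) ℝ)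
    (h0 : ∀ i, Q i 0 = w i.succ.succ 0)
    (h1 : ∀ i, Q i 1 = w i.succ.succ 1)
    (h2 : ∀ i (c : Fin n), Q i c.succ.succ = - redLap w i.succ c.succ.succ.succ) :
    ((redLap w).updateRow 0 v).det ^ 2 = Q.det ^ 2 := by
  set M := (redLap w).updateRow 0 v with hM
  have e1 : M.det = (M.updateCol 2 (fun k => ∑ i, (1 : ℝ) • M k i)).det := by
    rw [Matrix.det_updateCol_sum M 2 (fun _ => (1 : ℝ)), one_smul]
  set M' := M.updateCol 2 (fun k => ∑ i, (1 : ℝ) • M k i) with hM'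
  have h10 : (2 : Fin (n + 3)) ≠ 1 := by
    intro h; have := congrArg Fin.val h; simp at this; rw [Nat.mod_eq_of_lt (by omega)] at this; omega
  have hrow0 : ∀ j, M' 0 j = if j = 1 then 1 else 0 := by
    intro j
    rw [hM', Matrix.updateCol_apply]
    have hM0 : M 0 = v := by rw [hM]; exact Matrix.updateRow_self
    by_cases hj : j = 2
    · rw [if_pos hj, hM0, if_neg (by rw [hj]; exact h10)]
      simp [hv]
    · rw [if_neg hj, hM0, hv]
      simp [Pi.single_apply, hj]
  have e2 : M'.det = - (M'.submatrix Fin.succ (Fin.succAbove 1)).det := by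
    rw [Matrix.det_succ_row_zero, Finset.sum_eq_single 1]
    · rw [hrow0]; simp
    · intro b _ hb
      rw [hrow0, if_neg hb]; simp
    · simp
  have hMs : ∀ (i : Fin (n + 2)), M i.succ = redLap w i.succ := by
    intro i
    rw [hM]
    exact Matrix.updateRow_ne (Fin.succ_ne_zero i)
  have e3 : M'.submatrix Fin.succ (Fin.succAbove 1) =
      Matrix.of fun i c => (if c = 1 then (1 : ℝ) else -1) *
        (Q.submatrix id (Equiv.swap 0 1)) i c := by
    ext i c
    rw [Matrix.submatrix_apply, hM', Matrix.updateCol_apply, Matrix.of_apply,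
      Matrix.submatrix_apply, hMs]
    induction c using Fin.cases with
    | zero =>
      have a1 : (Fin.succAbove (1 : Fin (n + 3)) 0) = 0 := by
        simp
      rw [a1, if_neg, if_neg, Equiv.swap_apply_left, id, h1]
      · simp [redLap]
      · intro h; have := congrArg Fin.val h; simp at this
      · intro h; have := congrArg Fin.val h; simp at this; rw [Nat.mod_eq_of_lt (by omega)] at this; omega
    | succ c =>
      have a1 : (Fin.succAbove (1 : Fin (n + 3)) c.succ) = c.succ.succ := by
        rw [← Fin.succ_zero_eq_one, Fin.succ_succAbove_succ]
        simp
      rw [a1]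
      induction c using Fin.cases with
      | zero =>
        rw [if_pos (by rfl), if_pos (by rfl)]
        have : (Fin.succ 0 : Fin (n + 2)) = 1 := rfl
        rw [this, Equiv.swap_apply_right, id, h0]
        simp [redLap_row_sum]
      | succ c =>
        rw [if_neg, if_neg, Equiv.swap_apply_of_ne_of_ne, id, h2]
        · simp
        · exact Fin.succ_ne_zero _
        · intro h; have := congrArg Fin.val h; simp at this
        · intro h; have := congrArg Fin.val h; simp at this
        · intro h; have := congrArg Fin.val h; simp at this; rw [Nat.mod_eq_of_lt (by omega)] at this; omega
  rw [e1, e2, e3, Matrix.det_mul_row, Matrix.det_permute']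
  have hp : (∏ c : Fin (n + 2), (if c = 1 then (1 : ℝ) else -1)) ^ 2 = 1 := by
    rw [← Finset.prod_pow]
    refine Finset.prod_eq_one fun c _ => ?_
    split_ifs <;> norm_num
  rw [neg_sq, mul_pow, hp, mul_pow]
  simp

/-- Weight function of the single edge `{p,q}`. -/
noncomputable def edgeInd {N : ℕ} (p q : Fin N) (a b : Fin N) : ℝ :=
  (if a = p then 1 else 0) * (if b = q then 1 else 0)
    + (if a = q then 1 else 0) * (if b = p then 1 else 0)

/-- Signed incidence vector of the edge `{p,q}`. -/
noncomputable def incVec {m : ℕ} (p q : Fin (m + 1)) (i : Fin m) : ℝ :=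
  (if i.succ = p then 1 else 0) - (if i.succ = q then 1 else 0)

lemma redLap_add_edge {m : ℕ} (w : Fin (m + 1) → Fin (m + 1) → ℝ) (p q : Fin (m + 1))
    (hpq : p ≠ q) (s : ℝ) :
    redLap (fun a b => w a b + s * edgeInd p q a b) =
      redLap w + s • Matrix.vecMulVec (incVec p q) (incVec p q) := by
  ext i j
  have hs : ∑ k, edgeInd p q i.succ k =
      (if i.succ = p then 1 else 0) + (if i.succ = q then 1 else 0) := by
    simp only [edgeInd, Finset.sum_add_distrib, ← Finset.mul_sum]
    simp
  simp only [redLap, Matrix.of_apply, Matrix.add_apply, Matrix.smul_apply, Matrix.vecMulVec_apply,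
    Finset.sum_add_distrib, ← Finset.mul_sum, hs, smul_eq_mul]
  by_cases hij : i = j
  · subst hij
    simp only [edgeInd, incVec, if_true]
    by_cases h1 : i.succ = p <;> by_cases h2 : i.succ = q <;> simp_all <;> ring
  · have hij' : i.succ ≠ j.succ := fun h => hij (Fin.succ_inj.mp h)
    simp only [edgeInd, incVec, hij, if_false]
    by_cases h1 : i.succ = p <;> by_cases h2 : i.succ = q <;>
      by_cases h3 : j.succ = p <;> by_cases h4 : j.succ = q <;> simp_all <;> ring

lemma coeffA_eq {N : ℕ} (γ : Fin N → Fin N → ℝ) (i j k l : Fin N) (hij : i ≠ j) (hkl : k ≠ l)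
    (b1 b2 : Bool) :
    coeffA γ i j k l b1 b2 = ∑ T ∈ allTrees N,
      if (redPair i j ∈ T ↔ b1 = true) ∧ (redPair k l ∈ T ↔ b2 = true) then
        prodWeight γ (T \ {redPair i j, redPair k l}) else 0 := by
  rw [coeffA, ← Finset.sum_filter]
  apply Finset.sum_subset
  · intro T hT
    simp only [Finset.mem_filter, spTrees, allTrees, Finset.mem_univ, true_and] at hT ⊢
    obtain ⟨⟨hsub, htree⟩, hb⟩ := hT
    refine ⟨⟨fun p hp => ?_, htree⟩, hb⟩
    have := hsub hp
    simp only [Finset.mem_union, blackE, Finset.mem_filter, Finset.mem_univ, true_and,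
      Finset.mem_insert, Finset.mem_singleton] at this
    rcases this with h | rfl | rfl
    · exact h.1
    · exact redPair_lt hij
    · exact redPair_lt hkl
  · intro T hT hT'
    simp only [Finset.mem_filter, spTrees, allTrees, Finset.mem_univ, true_and] at hT hT'
    obtain ⟨⟨hlt, htree⟩, hb⟩ := hT
    have hns : ¬ T ⊆ blackE γ ∪ {redPair i j, redPair k l} := fun h => hT' ⟨⟨h, htree⟩, hb⟩
    obtain ⟨p, hp, hpn⟩ := Finset.not_subset.mp hns
    rw [Finset.mem_union, not_or] at hpn
    refine Finset.prod_eq_zero (Finset.mem_sdiff.mpr ⟨hp, hpn.2⟩) ?_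
    by_contra hne
    exact hpn.1 (Finset.mem_filter.mpr ⟨Finset.mem_univ _, hlt p hp, hne⟩)

lemma edgeInd_eq {N : ℕ} (p q a b : Fin N) (hpq : p ≠ q) :
    edgeInd p q a b = if redPair a b = redPair p q then 1 else 0 := by
  by_cases h : redPair a b = redPair p q
  · rw [if_pos h]
    rcases redPair_eq h with ⟨rfl, rfl⟩ | ⟨rfl, rfl⟩
    · simp [edgeInd, hpq]
    · simp [edgeInd, hpq]
  · rw [if_neg h]
    have h1 : ¬ (a = p ∧ b = q) := by rintro ⟨rfl, rfl⟩; exact h rfl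
    have h2 : ¬ (a = q ∧ b = p) := by rintro ⟨rfl, rfl⟩; exact h (redPair_comm _ _)
    simp only [edgeInd]
    by_cases a = p <;> by_cases b = q <;> by_cases a = q <;> by_cases b = p <;> simp_all

lemma prodWeight_red {N : ℕ} (γ : Fin N → Fin N → ℝ) (i j k l : Fin N) (hij : i < j) (hkl : k < l)
    (hne : redPair i j ≠ redPair k l) (h1 : γ i j = 0) (h2 : γ k l = 0) (s t : ℝ)
    (T : Finset (Fin N × Fin N)) (hT : ∀ p ∈ T, p.1 < p.2) :
    prodWeight (fun a b => γ a b + s * edgeInd i j a b + t * edgeInd k l a b) T =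
      prodWeight γ (T \ {redPair i j, redPair k l}) *
        ((if redPair i j ∈ T then s else 1) * (if redPair k l ∈ T then t else 1)) := by
  have e1 : redPair i j = (i, j) := redPair_of_lt (p := (i, j)) hij
  have e2 : redPair k l = (k, l) := redPair_of_lt (p := (k, l)) hkl
  unfold prodWeight
  rw [← Finset.prod_inter_mul_prod_sdiff T {redPair i j, redPair k l}, mul_comm]
  congr 1
  · refine Finset.prod_congr rfl fun p hp => ?_
    obtain ⟨hp, hn⟩ := Finset.mem_sdiff.mp hp
    beta_reduce
    rw [edgeInd_eq _ _ _ _ hij.ne, edgeInd_eq _ _ _ _ hkl.ne, redPair_of_lt (hT p hp)]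
    simp only [Finset.mem_insert, Finset.mem_singleton, not_or] at hn
    simp [hn.1, hn.2]
  · rw [Finset.inter_comm, ← Finset.filter_mem_eq_inter, Finset.prod_filter, Finset.prod_pair hne]
    congr 1
    · beta_reduce
      rw [edgeInd_eq _ _ _ _ hij.ne, edgeInd_eq _ _ _ _ hkl.ne,
        redPair_of_lt (redPair_lt hij.ne), if_neg hne]
      simp [e1, h1]
    · beta_reduce
      rw [edgeInd_eq _ _ _ _ hij.ne, edgeInd_eq _ _ _ _ hkl.ne,
        redPair_of_lt (redPair_lt hkl.ne), if_neg hne.symm]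
      simp [e2, h2]

lemma edgeInd_comm {N : ℕ} (p q a b : Fin N) : edgeInd p q a b = edgeInd p q b a := by
  simp only [edgeInd]; ring

lemma det_redLap_red {m : ℕ} (γ : Fin (m + 1) → Fin (m + 1) → ℝ) (hsym : ∀ a b, γ a b = γ b a)
    (i j k l : Fin (m + 1)) (hij : i < j) (hkl : k < l)
    (hne : redPair i j ≠ redPair k l) (h1 : γ i j = 0) (h2 : γ k l = 0) (s t : ℝ) :
    (redLap γ + s • Matrix.vecMulVec (incVec i j) (incVec i j)
      + t • Matrix.vecMulVec (incVec k l) (incVec k l)).det =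
    coeffA γ i j k l false false + s * coeffA γ i j k l true false
      + t * coeffA γ i j k l false true + s * t * coeffA γ i j k l true true := by
  rw [← redLap_add_edge γ i j hij.ne, ← redLap_add_edge _ k l hkl.ne, matrix_tree]
  · simp only [coeffA_eq γ i j k l hij.ne hkl.ne, Finset.mul_sum, ← Finset.sum_add_distrib]
    refine Finset.sum_congr rfl fun T hT => ?_
    rw [prodWeight_red γ i j k l hij hkl hne h1 h2 s t T (Finset.mem_filter.mp hT).2.1]
    by_cases ha : redPair i j ∈ T <;> by_cases hb : redPair k l ∈ T <;> simp [ha, hb] <;> ring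
  · intro a b
    simp only [hsym a b, edgeInd_comm _ _ a b]


lemma lapl_entry {n : ℕ} (γ : Fin (n + 4) → Fin (n + 4) → ℝ) (x y : ℝ) (a b : Fin (n + 4))
    (ha : 2 ≤ (a : ℕ)) (hb2 : (b : ℕ) ≠ 2) (hb3 : (b : ℕ) ≠ 3) :
    lapl (fun a b =>
            if (a = 0 ∧ b = 1) ∨ (a = 1 ∧ b = 0) then -x
            else if (a = 2 ∧ b = 3) ∨ (a = 3 ∧ b = 2) then -y
            else γ a b) a b = γ a b - if a = b then ∑ k, γ a k else 0 := by
  have v2 : ((2 : Fin (n + 4)) : ℕ) = 2 := Nat.mod_eq_of_lt (show 2 < _ by omega)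
  have v3 : ((3 : Fin (n + 4)) : ℕ) = 3 := Nat.mod_eq_of_lt (show 3 < _ by omega)
  have a0 : a ≠ 0 := by rintro rfl; simp at ha
  have a1 : a ≠ 1 := by rintro rfl; simp at ha
  have b2 : b ≠ 2 := by rintro rfl; exact hb2 v2
  have b3 : b ≠ 3 := by rintro rfl; exact hb3 v3
  by_cases hab : a = b
  · subst hab
    simp only [lapl, Matrix.of_apply, if_true, a0, a1, b2, b3, false_and, or_self, if_false]
    rw [Finset.filter_ne', ← Finset.add_sum_erase _ _ (Finset.mem_univ a)]
    ring
  · simp [lapl, hab, a0, a1, b2, b3]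

/-- **Δ = −(det L_{12,34})² (disjoint red edges).**  For a connected weighted
graph on `n+4 ≥ 4` vertices whose red edges are `{1,2}` (weight `−x`) and
`{3,4}` (weight `−y`) (here `0,1,2,3` in `Fin (n+4)`), the discriminant equals
minus the square of the determinant of the submatrix of the Laplacian obtained
by deleting rows `1,2` and columns `3,4`. -/
theorem discriminant_eq_neg_square_minor_disjoint
    {n : ℕ} (γ : Fin (n + 4) → Fin (n + 4) → ℝ)
    (hsym : ∀ a b, γ a b = γ b a) (hdiag : ∀ a, γ a a = 0)
    (hpos : ∀ a b, 0 ≤ γ a b)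
    (hred1 : γ 0 1 = 0) (hred2 : γ 2 3 = 0)
    (hconn : (edgeGraph (blackE γ ∪ {redPair 0 1, redPair 2 3})).Connected)
    (x y : ℝ) :
    crossDisc γ 0 1 2 3 =
      -(((lapl (fun a b =>
            if (a = 0 ∧ b = 1) ∨ (a = 1 ∧ b = 0) then -x
            else if (a = 2 ∧ b = 3) ∨ (a = 3 ∧ b = 2) then -y
            else γ a b)).submatrix
          (fun r : Fin (n + 2) =>
            (⟨(r : ℕ) + 2, by have := r.isLt; omega⟩ : Fin (n + 4)))
          (fun c : Fin (n + 2) =>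
            if (c : ℕ) < 2 then (⟨(c : ℕ), by have := c.isLt; omega⟩ : Fin (n + 4))
            else (⟨(c : ℕ) + 2, by have := c.isLt; omega⟩ : Fin (n + 4)))).det) ^ 2 := by
  have h01 : (0 : Fin (n + 4)) < 1 := by simp
  have v2 : ((2 : Fin (n + 4)) : ℕ) = 2 := Nat.mod_eq_of_lt (show 2 < _ by omega)
  have v3 : ((3 : Fin (n + 4)) : ℕ) = 3 := Nat.mod_eq_of_lt (show 3 < _ by omega)
  have h23 : (2 : Fin (n + 4)) < 3 := by
    rw [Fin.lt_def, v2, v3]; omega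
  have hne : redPair (0 : Fin (n + 4)) 1 ≠ redPair 2 3 := by
    intro h
    rcases redPair_eq h with ⟨h, -⟩ | ⟨h, -⟩
    · have := congrArg Fin.val h; rw [v2] at this; simp at this
    · have := congrArg Fin.val h; rw [v3] at this; simp at this
  have D := det_redLap_red γ hsym 0 1 2 3 h01 h23 hne hred1 hred2
  have D00 := D 0 0
  have D10 := D 1 0
  have D01 := D 0 1
  have D11 := D 1 1
  simp only [zero_smul, one_smul, add_zero, zero_mul, one_mul, mul_zero] at D00 D10 D01 D11
  set K := redLap γ with hK
  have hKt : K.transpose = K := redLap_transpose γ hsym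
  have hadj : K.adjugate.transpose = K.adjugate := by rw [Matrix.adjugate_transpose, hKt]
  have R := det_rank_two K (incVec 0 1) (incVec 2 3)
  rw [D00, D10, D01, D11] at R
  have hu : incVec (0 : Fin (n + 4)) 1 = -Pi.single (0 : Fin (n + 3)) (1 : ℝ) := by
    funext i
    have : i.succ = (1 : Fin (n + 4)) ↔ i = 0 := by
      rw [← Fin.succ_zero_eq_one, Fin.succ_inj]
    simp [incVec, Fin.succ_ne_zero, this, Pi.single_apply]
  have hv : incVec (2 : Fin (n + 4)) 3 = Pi.single (1 : Fin (n + 3)) (1 : ℝ) - Pi.single 2 1 := by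
    funext i
    have a : i.succ = (2 : Fin (n + 4)) ↔ i = 1 := by
      rw [Fin.ext_iff, v2, Fin.ext_iff, Fin.val_succ, Fin.val_one]; omega
    have b : i.succ = (3 : Fin (n + 4)) ↔ i = 2 := by
      have v2' : ((2 : Fin (n + 3)) : ℕ) = 2 := Nat.mod_eq_of_lt (show 2 < _ by omega)
      rw [Fin.ext_iff, v3, Fin.ext_iff, Fin.val_succ, v2']; omega
    simp [incVec, a, b, Pi.single_apply]
  have hsw : incVec (2 : Fin (n + 4)) 3 ⬝ᵥ K.adjugate.mulVec (incVec 0 1) =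
      incVec (0 : Fin (n + 4)) 1 ⬝ᵥ K.adjugate.mulVec (incVec 2 3) := by
    rw [dotProduct_comm, ← Matrix.vecMul_transpose, hadj, Matrix.dotProduct_mulVec]
  have hdet : incVec (0 : Fin (n + 4)) 1 ⬝ᵥ K.adjugate.mulVec (incVec 2 3) =
      -(K.updateRow 0 (incVec 2 3)).det := by
    rw [hu, ← Matrix.cramer_transpose_apply, hKt, Matrix.cramer_eq_adjugate_mulVec]
    simp
  rw [hsw, hdet] at R
  have hC : crossDisc γ 0 1 2 3 = -((K.updateRow 0 (incVec 2 3)).det) ^ 2 := by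
    rw [crossDisc]
    linarith
  rw [hC]
  congr 1
  refine minor_sq γ _ hv _ ?_ ?_ ?_
  · intro i
    rw [Matrix.submatrix_apply, if_pos (show ((0 : Fin (n + 2)) : ℕ) < 2 by simp), lapl_entry]
    · rw [if_neg]
      · simp only [sub_zero]
        rfl
      · intro h; have := congrArg Fin.val h; simp at this
    · simp
    · simp
    · simp
  · intro i
    rw [Matrix.submatrix_apply, if_pos (show ((1 : Fin (n + 2)) : ℕ) < 2 by simp), lapl_entry]
    · rw [if_neg]
      · simp only [sub_zero]
        rfl
      · intro h; have := congrArg Fin.val h; simp at this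
    · simp
    · simp
    · simp
  · intro i c
    have hc : ¬ ((c.succ.succ : Fin (n + 2)) : ℕ) < 2 := by simp
    rw [Matrix.submatrix_apply, if_neg hc, lapl_entry]
    · have e1 : (⟨(i : ℕ) + 2, by have := i.isLt; omega⟩ : Fin (n + 4)) = i.succ.succ := rfl
      have e2 : (⟨(c.succ.succ : Fin (n + 2)) + 2, by have := c.isLt; simp⟩ : Fin (n + 4))
        = c.succ.succ.succ.succ := rfl
      rw [e1, e2]
      simp only [redLap, Matrix.of_apply, Fin.succ_inj]
      ring
    · simp
    · simp
    · simp
end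

section
/- Stability via an ℓ¹ condition: Let Γ_+ be a connected weighted graph on {1,…,N} with all weights positive, and let e_1,…,e_R be R additional distinct vertex pairs (red edges) not among the edges of Γ_+. For each i define ω_i = ( Σ_{T spanning tree of Γ_+} π(T) ) / ( Σ_{T spanning tree of Γ_+ ∪ {e_i} containing e_i} π̃(T) ), where π(T) is the product of the weights of the edges of T and π̃(T) is the product of the weights of the black edges of T (i.e., omitting e_i). Then for any t = (t_1,…,t_R) with t_i ≥ 0 and Σ_{i=1}^R t_i < min_i ω_i, the Laplacian of the weighted graph Γ(t), which carries the weights of Γ_+ on the black edges and weight −t_i on e_i, has spectral index (n_−, n_0, n_+) = (N−1, 1, 0); that is, it is negative semidefinite with kernel exactly the span of the all-ones vector. -/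
open Finset
open scoped Classical

/-- The number of negative eigenvalues (`n₋`) of a real symmetric matrix,
counted with multiplicity. -/
noncomputable def negCount {N : ℕ} (A : Matrix (Fin N) (Fin N) ℝ)
    (hA : A.IsHermitian) : ℕ :=
  (univ.filter fun i => hA.eigenvalues i < 0).card

/-- The number of zero eigenvalues (`n₀`) of a real symmetric matrix,
counted with multiplicity. -/
noncomputable def zeroCount {N : ℕ} (A : Matrix (Fin N) (Fin N) ℝ)
    (hA : A.IsHermitian) : ℕ :=
  (univ.filter fun i => hA.eigenvalues i = 0).card

/-- The number of positive eigenvalues (`n₊`) of a real symmetric matrix,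
counted with multiplicity. -/
noncomputable def posCount {N : ℕ} (A : Matrix (Fin N) (Fin N) ℝ)
    (hA : A.IsHermitian) : ℕ :=
  (univ.filter fun i => 0 < hA.eigenvalues i).card

/-- The sum of `π(T)` over all spanning trees `T` of the positive part `Γ₊`. -/
noncomputable def treeSum {N : ℕ} (γ : Fin N → Fin N → ℝ) : ℝ :=
  ∑ T ∈ univ.filter (fun T : Finset (Fin N × Fin N) =>
      T ⊆ blackE γ ∧ (edgeGraph T).IsTree), prodWeight γ T

/-- The sum of `π̃(T)` (product of black weights) over all spanning trees of
`Γ₊ ∪ {p}` containing the extra edge `p`. -/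
noncomputable def redDenom {N : ℕ} (γ : Fin N → Fin N → ℝ) (p : Fin N × Fin N) : ℝ :=
  ∑ T ∈ univ.filter (fun T : Finset (Fin N × Fin N) =>
      T ⊆ insert p (blackE γ) ∧ (edgeGraph T).IsTree ∧ p ∈ T),
    prodWeight γ (T.erase p)

/-- All pairs in `F` are increasing. -/
def OrdPairs {N : ℕ} (F : Finset (Fin N × Fin N)) : Prop := ∀ q ∈ F, q.1 < q.2

lemma edgeGraph_insert {N : ℕ} (F : Finset (Fin N × Fin N)) (q : Fin N × Fin N) :
    edgeGraph (insert q F) = edgeGraph F ⊔ SimpleGraph.edge q.1 q.2 := by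
  ext a b
  obtain ⟨c, d⟩ := q
  simp only [edgeGraph, SimpleGraph.fromRel_adj, SimpleGraph.sup_adj, SimpleGraph.edge_adj,
    Finset.mem_insert, Prod.mk.injEq]
  grind

lemma tree_insert_iff {N : ℕ} {F : Finset (Fin N × Fin N)} {q : Fin N × Fin N}
    (hF : OrdPairs F) (hq : q.1 < q.2) (hqF : q ∉ F) :
    (edgeGraph (insert q F)).IsTree ↔ (edgeGraph F).IsAcyclic ∧
      ¬ (edgeGraph F).Reachable q.1 q.2 ∧
      ∀ v, (edgeGraph F).Reachable v q.1 ∨ (edgeGraph F).Reachable v q.2 := by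
  rw [edgeGraph_insert]
  have hnadj : ¬ (edgeGraph F).Adj q.1 q.2 := by
    simp only [edgeGraph, SimpleGraph.fromRel_adj]
    rintro ⟨_, h | h⟩
    · exact hqF h
    · exact absurd (hF _ h) (not_lt.2 hq.le)
  have hne : q.1 ≠ q.2 := hq.ne
  rw [SimpleGraph.isTree_iff, SimpleGraph.isAcyclic_sup_fromEdgeSet_iff]
  have key : ∀ v w, (edgeGraph F ⊔ SimpleGraph.edge q.1 q.2).Reachable v w →
      ((edgeGraph F).Reachable w q.1 ∨ (edgeGraph F).Reachable w q.2) →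
      ((edgeGraph F).Reachable v q.1 ∨ (edgeGraph F).Reachable v q.2) := by
    rintro v w ⟨p⟩
    induction p with
    | nil => exact id
    | cons h p ih =>
      intro hw
      have := ih hw
      rw [SimpleGraph.sup_adj, SimpleGraph.edge_adj] at h
      rcases h with h | ⟨⟨h1, h2⟩ | ⟨h1, h2⟩, _⟩
      · exact this.imp h.reachable.trans h.reachable.trans
      · left; rw [h1]
      · right; rw [h1]
  constructor
  · rintro ⟨hc, ha, hr⟩
    refine ⟨ha, fun h => ?_, fun v => ?_⟩
    · rcases hr h with h | h
      · exact hne h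
      · exact hnadj h
    · exact key v q.1 (hc.preconnected _ _) (Or.inl (SimpleGraph.Reachable.refl _))
  · rintro ⟨ha, hr, hv⟩
    refine ⟨?_, ha, fun h => absurd h hr⟩
    have hle : edgeGraph F ≤ edgeGraph F ⊔ SimpleGraph.edge q.1 q.2 := le_sup_left
    have h12 : (edgeGraph F ⊔ SimpleGraph.edge q.1 q.2).Reachable q.2 q.1 := by
      apply SimpleGraph.Adj.reachable
      rw [SimpleGraph.sup_adj, SimpleGraph.edge_adj]
      exact Or.inr ⟨Or.inr ⟨rfl, rfl⟩, hne.symm⟩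
    have hall : ∀ v, (edgeGraph F ⊔ SimpleGraph.edge q.1 q.2).Reachable v q.1 := by
      intro v
      rcases hv v with h | h
      · exact h.mono hle
      · exact (h.mono hle).trans h12
    haveI : Nonempty (Fin N) := ⟨q.1⟩
    exact ⟨fun u v => (hall u).trans (hall v).symm⟩

/-- Indicator of reachability in the forest `F`. -/
noncomputable def rch {N : ℕ} (F : Finset (Fin N × Fin N)) (u v : Fin N) : ℝ :=
  if (edgeGraph F).Reachable u v then 1 else 0

/-- Difference along an ordered pair. -/
def dif {N : ℕ} (x : Fin N → ℝ) (q : Fin N × Fin N) : ℝ := x q.1 - x q.2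

lemma tree_telescope {N : ℕ} {T : Finset (Fin N × Fin N)} (hT : OrdPairs T)
    (htree : (edgeGraph T).IsTree) (x : Fin N → ℝ) (a b : Fin N) :
    ∑ q ∈ T, (rch (T.erase q) a q.1 - rch (T.erase q) b q.1) * dif x q = x a - x b := by
  have hsep : ∀ q ∈ T, ¬ (edgeGraph (T.erase q)).Reachable q.1 q.2 := by
    intro q hq
    have h := (tree_insert_iff (F := T.erase q) (q := q)
      (fun r hr => hT r (Finset.mem_of_mem_erase hr)) (hT q hq) (Finset.notMem_erase _ _)).1
      (by rw [Finset.insert_erase hq]; exact htree)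
    exact h.2.1
  -- one step along an edge
  have hedge : ∀ q ∈ T, ∀ r ∈ T, rch (T.erase r) q.1 r.1 - rch (T.erase r) q.2 r.1
      = if r = q then 1 else 0 := by
    intro q hq r hr
    split_ifs with h
    · subst h
      have := hsep r hr
      have h2 : ¬ (edgeGraph (T.erase r)).Reachable r.2 r.1 := fun h => this h.symm
      simp [rch, h2]
    · have hadj : (edgeGraph (T.erase r)).Adj q.1 q.2 := by
        simp only [edgeGraph, SimpleGraph.fromRel_adj]
        exact ⟨(hT q hq).ne, Or.inl (Finset.mem_erase.2 ⟨fun h' => h h'.symm, hq⟩)⟩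
      have : (edgeGraph (T.erase r)).Reachable q.1 r.1 ↔
          (edgeGraph (T.erase r)).Reachable q.2 r.1 :=
        ⟨fun h => hadj.symm.reachable.trans h, fun h => hadj.reachable.trans h⟩
      simp [rch, this]
  have hstep : ∀ q ∈ T,
      ∑ r ∈ T, (rch (T.erase r) q.1 r.1 - rch (T.erase r) q.2 r.1) * dif x r
        = x q.1 - x q.2 := by
    intro q hq
    rw [Finset.sum_congr rfl (fun r hr => by rw [hedge q hq r hr])]
    simp [hq, dif]
  obtain ⟨p⟩ := htree.1.preconnected a b
  induction p with
  | nil => simp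
  | @cons u v w h p ih =>
    have hs : ∑ q ∈ T, (rch (T.erase q) u q.1 - rch (T.erase q) v q.1) * dif x q
        = x u - x v := by
      simp only [edgeGraph, SimpleGraph.fromRel_adj] at h
      rcases h.2 with h | h
      · exact hstep _ h
      · have := hstep _ h
        simp only at this
        rw [← neg_sub (x v), ← this, ← Finset.sum_neg_distrib]
        exact Finset.sum_congr rfl (fun r _ => by ring)
    have e1 : x u - x w = (x u - x v) + (x v - x w) := by ring
    rw [e1, ← hs, ← ih, ← Finset.sum_add_distrib]
    exact Finset.sum_congr rfl (fun r _ => by ring)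

/-- Spanning trees of the black graph. -/
noncomputable def treesB {N : ℕ} (γ : Fin N → Fin N → ℝ) : Finset (Finset (Fin N × Fin N)) :=
  univ.filter (fun T : Finset (Fin N × Fin N) => T ⊆ blackE γ ∧ (edgeGraph T).IsTree)

/-- Spanning trees of the black graph plus `p` that contain `p`. -/
noncomputable def treesP {N : ℕ} (γ : Fin N → Fin N → ℝ) (p : Fin N × Fin N) :
    Finset (Finset (Fin N × Fin N)) :=
  univ.filter (fun T : Finset (Fin N × Fin N) =>
      T ⊆ insert p (blackE γ) ∧ (edgeGraph T).IsTree ∧ p ∈ T)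

/-- The (unnormalised) Kirchhoff potential. -/
noncomputable def pot {N : ℕ} (γ : Fin N → Fin N → ℝ) (p : Fin N × Fin N) (c : Fin N) : ℝ :=
  ∑ T ∈ treesP γ p, prodWeight γ (T.erase p) * rch (T.erase p) c p.1

/-- The Dirichlet form. -/
noncomputable def dform {N : ℕ} (γ : Fin N → Fin N → ℝ) (x y : Fin N → ℝ) : ℝ :=
  ∑ q ∈ blackE γ, γ q.1 q.2 * dif x q * dif y q

lemma blackE_ord {N : ℕ} (γ : Fin N → Fin N → ℝ) : OrdPairs (blackE γ) := by
  intro q hq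
  exact (Finset.mem_filter.1 hq).2.1

lemma coef_eq {N : ℕ} {F : Finset (Fin N × Fin N)} {p q : Fin N × Fin N}
    (h1 : ¬ (edgeGraph F).Reachable q.1 q.2)
    (h2 : ¬ (edgeGraph F).Reachable p.1 p.2)
    (hp : ∀ v, (edgeGraph F).Reachable v p.1 ∨ (edgeGraph F).Reachable v p.2) :
    rch F q.1 p.1 - rch F q.2 p.1 = rch F p.1 q.1 - rch F p.2 q.1 := by
  unfold rch
  by_cases hq : (edgeGraph F).Reachable q.1 p.1
  · have a1 : ¬ (edgeGraph F).Reachable q.2 p.1 := fun h => h1 (hq.trans h.symm)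
    have a2 : ¬ (edgeGraph F).Reachable p.2 q.1 := fun h => h2 (h.trans hq).symm
    simp [hq, a1, a2, hq.symm]
  · have b1 := (hp q.1).resolve_left hq
    have b2 : (edgeGraph F).Reachable q.2 p.1 :=
      (hp q.2).resolve_right fun h => h1 (b1.trans h.symm)
    have b3 : ¬ (edgeGraph F).Reachable p.1 q.1 := fun h => hq h.symm
    simp [hq, b2, b3, b1.symm]

lemma exchange {N : ℕ} {F : Finset (Fin N × Fin N)} {p q : Fin N × Fin N}
    (hF : OrdPairs F) (hq : q.1 < q.2) (hqF : q ∉ F) (hp : p.1 < p.2) (hpF : p ∉ F)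
    (h1 : ¬ (edgeGraph F).Reachable q.1 q.2)
    (ht : (edgeGraph (insert p F)).IsTree) : (edgeGraph (insert q F)).IsTree := by
  obtain ⟨ha, hr, hv⟩ := (tree_insert_iff hF hp hpF).1 ht
  refine (tree_insert_iff hF hq hqF).2 ⟨ha, h1, fun v => ?_⟩
  rcases hv q.1 with a | a
  · have b : (edgeGraph F).Reachable q.2 p.2 :=
      (hv q.2).resolve_left fun h => h1 (a.trans h.symm)
    exact (hv v).imp (fun h => h.trans a.symm) (fun h => h.trans b.symm)
  · have b : (edgeGraph F).Reachable q.2 p.1 :=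
      (hv q.2).resolve_right fun h => h1 (a.trans h.symm)
    exact (hv v).symm.imp (fun h => h.trans a.symm) (fun h => h.trans b.symm)

lemma not_mem_of_not_reach {N : ℕ} {F : Finset (Fin N × Fin N)} {q : Fin N × Fin N}
    (hq : q.1 < q.2) (h : ¬ (edgeGraph F).Reachable q.1 q.2) : q ∉ F := by
  intro hm
  apply h
  apply SimpleGraph.Adj.reachable
  simp only [edgeGraph, SimpleGraph.fromRel_adj]
  exact ⟨hq.ne, Or.inl hm⟩

lemma dform_pot {N : ℕ} (γ : Fin N → Fin N → ℝ) (p : Fin N × Fin N) (hp : p.1 < p.2)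
    (hp0 : γ p.1 p.2 = 0) (x : Fin N → ℝ) :
    dform γ (pot γ p) x = treeSum γ * (x p.1 - x p.2) := by
  have hpB : p ∉ blackE γ := by simp [blackE, hp0]
  have hB := blackE_ord γ
  have hL : dform γ (pot γ p) x = ∑ z ∈ (treesP γ p ×ˢ blackE γ).filter
      (fun z => ¬ (edgeGraph (z.1.erase p)).Reachable z.2.1 z.2.2),
      γ z.2.1 z.2.2 * prodWeight γ (z.1.erase p) *
        ((rch (z.1.erase p) z.2.1 p.1 - rch (z.1.erase p) z.2.2 p.1) * dif x z.2) := by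
    rw [Finset.sum_filter_of_ne, Finset.sum_product_right]
    · unfold dform
      refine Finset.sum_congr rfl fun q hq => ?_
      simp only [dif, pot]
      rw [← Finset.sum_sub_distrib, Finset.mul_sum, Finset.sum_mul]
      exact Finset.sum_congr rfl fun T hT => by ring
    · rintro ⟨T, q⟩ hz hne hr
      apply hne
      simp only at hr
      have : (edgeGraph (T.erase p)).Reachable q.1 p.1 ↔
          (edgeGraph (T.erase p)).Reachable q.2 p.1 :=
        ⟨fun h => hr.symm.trans h, fun h => hr.trans h⟩
      simp [rch, this]
  have hR : treeSum γ * (x p.1 - x p.2) = ∑ z ∈ (treesB γ ×ˢ blackE γ).filter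
      (fun z => z.2 ∈ z.1 ∧ ¬ (edgeGraph (z.1.erase z.2)).Reachable p.1 p.2),
      prodWeight γ z.1 *
        ((rch (z.1.erase z.2) p.1 z.2.1 - rch (z.1.erase z.2) p.2 z.2.1) * dif x z.2) := by
    rw [← Finset.filter_filter, Finset.sum_filter_of_ne, Finset.sum_filter, Finset.sum_product]
    · unfold treeSum
      rw [Finset.sum_mul]
      refine Finset.sum_congr rfl fun T hT => ?_
      obtain ⟨hTB, hTt⟩ := (Finset.mem_filter.1 hT).2
      rw [← Finset.sum_filter]
      have : (blackE γ).filter (fun q => q ∈ T) = T := by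
        ext q
        simp only [Finset.mem_filter]
        exact ⟨fun h => h.2, fun h => ⟨hTB h, h⟩⟩
      simp only [this]
      rw [← Finset.mul_sum, tree_telescope (fun r hr => hB r (hTB hr)) hTt]
    · rintro ⟨T, q⟩ hz hne hr
      apply hne
      simp only at hr
      have : (edgeGraph (T.erase q)).Reachable p.1 q.1 ↔
          (edgeGraph (T.erase q)).Reachable p.2 q.1 :=
        ⟨fun h => hr.symm.trans h, fun h => hr.trans h⟩
      simp [rch, this]
  rw [hL, hR]
  -- the exchange bijection
  have main1 : ∀ z ∈ (treesP γ p ×ˢ blackE γ).filter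
      (fun z => ¬ (edgeGraph (z.1.erase p)).Reachable z.2.1 z.2.2),
      p ∈ z.1 ∧ z.1.erase p ⊆ blackE γ ∧ z.2 ∈ blackE γ ∧ z.2 ∉ z.1.erase p ∧
      (edgeGraph (insert p (z.1.erase p))).IsTree ∧
      (edgeGraph (insert z.2 (z.1.erase p))).IsTree := by
    rintro ⟨T, q⟩ hz
    simp only [Finset.mem_filter, Finset.mem_product, treesP, Finset.mem_univ, true_and] at hz
    obtain ⟨⟨⟨hTs, hTt, hpT⟩, hq⟩, hr⟩ := hz
    have hsub : T.erase p ⊆ blackE γ := by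
      intro r hr
      obtain ⟨h1, h2⟩ := Finset.mem_erase.1 hr
      exact (Finset.mem_insert.1 (hTs h2)).resolve_left h1
    have hqF : q ∉ T.erase p := not_mem_of_not_reach (hB q hq) hr
    have ht' : (edgeGraph (insert p (T.erase p))).IsTree := by rwa [Finset.insert_erase hpT]
    exact ⟨hpT, hsub, hq, hqF, ht', exchange (fun r hr => hB r (hsub hr)) (hB q hq) hqF hp
      (Finset.notMem_erase _ _) hr ht'⟩
  have main2 : ∀ z ∈ (treesB γ ×ˢ blackE γ).filter
      (fun z => z.2 ∈ z.1 ∧ ¬ (edgeGraph (z.1.erase z.2)).Reachable p.1 p.2),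
      z.2 ∈ z.1 ∧ z.1.erase z.2 ⊆ blackE γ ∧ z.2 ∈ blackE γ ∧ p ∉ z.1.erase z.2 ∧
      (edgeGraph (insert z.2 (z.1.erase z.2))).IsTree ∧
      (edgeGraph (insert p (z.1.erase z.2))).IsTree := by
    rintro ⟨T, q⟩ hz
    simp only [Finset.mem_filter, Finset.mem_product, treesB, Finset.mem_univ, true_and] at hz
    obtain ⟨⟨⟨hTs, hTt⟩, hq⟩, hqT, hr⟩ := hz
    have hsub : T.erase q ⊆ blackE γ := (Finset.erase_subset _ _).trans hTs
    have hpF : p ∉ T.erase q := fun h => hpB (hsub h)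
    have ht' : (edgeGraph (insert q (T.erase q))).IsTree := by rwa [Finset.insert_erase hqT]
    exact ⟨hqT, hsub, hq, hpF, ht', exchange (fun r hr => hB r (hsub hr)) hp hpF (hB q hq)
      (Finset.notMem_erase _ _) hr ht'⟩
  refine Finset.sum_nbij' (fun z => (insert z.2 (z.1.erase p), z.2))
    (fun z => (insert p (z.1.erase z.2), z.2)) ?_ ?_ ?_ ?_ ?_
  · intro z hz
    obtain ⟨hpT, hsub, hq, hqF, ht1, ht2⟩ := main1 z hz
    simp only [Finset.mem_filter, Finset.mem_product, treesB, Finset.mem_univ, true_and]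
    refine ⟨⟨⟨Finset.insert_subset hq hsub, ht2⟩, hq⟩, Finset.mem_insert_self _ _, ?_⟩
    rw [Finset.erase_insert hqF]
    exact ((tree_insert_iff (fun r hr => hB r (hsub hr)) hp (Finset.notMem_erase _ _)).1 ht1).2.1
  · intro z hz
    obtain ⟨hqT, hsub, hq, hpF, ht1, ht2⟩ := main2 z hz
    simp only [Finset.mem_filter, Finset.mem_product, treesP, Finset.mem_univ, true_and]
    refine ⟨⟨⟨Finset.insert_subset_insert _ hsub, ht2, Finset.mem_insert_self _ _⟩, hq⟩, ?_⟩
    rw [Finset.erase_insert hpF]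
    exact ((tree_insert_iff (fun r hr => hB r (hsub hr)) (hB _ hq)
      (Finset.notMem_erase _ _)).1 ht1).2.1
  · intro z hz
    obtain ⟨hpT, hsub, hq, hqF, ht1, ht2⟩ := main1 z hz
    simp only [Finset.erase_insert hqF, Finset.insert_erase hpT]
  · intro z hz
    obtain ⟨hqT, hsub, hq, hpF, ht1, ht2⟩ := main2 z hz
    simp only [Finset.erase_insert hpF, Finset.insert_erase hqT]
  · intro z hz
    obtain ⟨hpT, hsub, hq, hqF, ht1, ht2⟩ := main1 z hz
    simp only [Finset.erase_insert hqF]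
    have ho : OrdPairs (z.1.erase p) := fun r hr => hB r (hsub hr)
    have i1 := (tree_insert_iff ho hp (Finset.notMem_erase _ _)).1 ht1
    have i2 := (tree_insert_iff ho (hB _ hq) hqF).1 ht2
    rw [coef_eq i2.2.1 i1.2.1 i1.2.2]
    congr 1
    unfold prodWeight
    rw [Finset.prod_insert hqF]

lemma pot_diff {N : ℕ} (γ : Fin N → Fin N → ℝ) (p : Fin N × Fin N) (hp : p.1 < p.2)
    (hp0 : γ p.1 p.2 = 0) : pot γ p p.1 - pot γ p p.2 = redDenom γ p := by
  unfold pot redDenom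
  rw [← Finset.sum_sub_distrib]
  refine Finset.sum_congr rfl fun T hT => ?_
  obtain ⟨hTs, hTt, hpT⟩ := (Finset.mem_filter.1 hT).2
  have hsub : T.erase p ⊆ blackE γ := by
    intro r hr
    obtain ⟨h1, h2⟩ := Finset.mem_erase.1 hr
    exact (Finset.mem_insert.1 (hTs h2)).resolve_left h1
  have i1 := (tree_insert_iff (F := T.erase p) (fun r hr => blackE_ord γ r (hsub hr)) hp
    (Finset.notMem_erase _ _)).1 (by rwa [Finset.insert_erase hpT])
  have h2 : ¬ (edgeGraph (T.erase p)).Reachable p.2 p.1 := fun h => i1.2.1 h.symm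
  simp [rch, h2]

lemma resistance {N : ℕ} (γ : Fin N → Fin N → ℝ) (hpos : ∀ a b, 0 ≤ γ a b)
    (p : Fin N × Fin N) (hp : p.1 < p.2)
    (hp0 : γ p.1 p.2 = 0) (hD : 0 < redDenom γ p) (x : Fin N → ℝ) :
    treeSum γ * dif x p ^ 2 ≤ redDenom γ p * dform γ x x := by
  have h1 := dform_pot γ p hp hp0 x
  have h2 := dform_pot γ p hp hp0 (pot γ p)
  rw [pot_diff γ p hp hp0] at h2
  have h3 : 0 ≤ ∑ q ∈ blackE γ, γ q.1 q.2 *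
      (redDenom γ p * dif x q - dif x p * dif (pot γ p) q) ^ 2 :=
    Finset.sum_nonneg fun q _ => mul_nonneg (hpos _ _) (sq_nonneg _)
  have h4 : ∑ q ∈ blackE γ, γ q.1 q.2 *
      (redDenom γ p * dif x q - dif x p * dif (pot γ p) q) ^ 2 =
      redDenom γ p ^ 2 * dform γ x x - 2 * redDenom γ p * dif x p * dform γ (pot γ p) x
        + dif x p ^ 2 * dform γ (pot γ p) (pot γ p) := by
    unfold dform
    rw [Finset.mul_sum, Finset.mul_sum, Finset.mul_sum, ← Finset.sum_sub_distrib,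
      ← Finset.sum_add_distrib]
    exact Finset.sum_congr rfl fun q _ => by ring
  rw [h4, h1, h2] at h3
  have h5 : 0 ≤ redDenom γ p * (redDenom γ p * dform γ x x - treeSum γ * dif x p ^ 2) := by
    have : x p.1 - x p.2 = dif x p := rfl
    rw [this] at h3
    linarith
  linarith [nonneg_of_mul_nonneg_right h5 hD]

lemma lapl_form {N : ℕ} (g : Fin N → Fin N → ℝ) (hs : ∀ a b, g a b = g b a) (x : Fin N → ℝ) :
    x ⬝ᵥ (Matrix.mulVec (lapl g) x) =
      -∑ q ∈ univ.filter (fun q : Fin N × Fin N => q.1 < q.2), g q.1 q.2 * dif x q ^ 2 := by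
  have hL : ∀ i j, lapl g i j = g i j - if i = j then ∑ k, g i k else 0 := by
    intro i j
    simp only [lapl, Matrix.of_apply]
    split_ifs with h
    · subst h
      rw [Finset.filter_ne', ← Finset.add_sum_erase _ _ (Finset.mem_univ i)]
      ring
    · ring
  have e1 : x ⬝ᵥ (Matrix.mulVec (lapl g) x) =
      ∑ i, ∑ j, g i j * x i * x j - ∑ i, ∑ j, g i j * x i ^ 2 := by
    simp only [dotProduct, Matrix.mulVec, hL]
    rw [← Finset.sum_sub_distrib]
    refine Finset.sum_congr rfl fun i _ => ?_
    simp only [sub_mul, Finset.sum_sub_distrib, ite_mul, zero_mul, Finset.sum_ite_eq,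
      Finset.mem_univ, if_true, mul_sub, Finset.mul_sum, Finset.sum_mul]
    congr 1
    · exact Finset.sum_congr rfl fun j _ => by ring
    · exact Finset.sum_congr rfl fun j _ => by ring
  have e2 : ∑ i, ∑ j, g i j * x i ^ 2 = ∑ i, ∑ j, g i j * x j ^ 2 := by
    rw [Finset.sum_comm]
    exact Finset.sum_congr rfl fun i _ => Finset.sum_congr rfl fun j _ => by rw [hs]
  have e3 : ∑ i, ∑ j, g i j * (x i - x j) ^ 2 =
      ∑ i, ∑ j, g i j * x i ^ 2 + ∑ i, ∑ j, g i j * x j ^ 2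
        - 2 * ∑ i, ∑ j, g i j * x i * x j := by
    simp only [Finset.mul_sum, ← Finset.sum_add_distrib, ← Finset.sum_sub_distrib]
    exact Finset.sum_congr rfl fun i _ => Finset.sum_congr rfl fun j _ => by ring
  have e4 : ∑ i, ∑ j, g i j * (x i - x j) ^ 2 =
      2 * ∑ q ∈ univ.filter (fun q : Fin N × Fin N => q.1 < q.2), g q.1 q.2 * dif x q ^ 2 := by
    have : ∑ i, ∑ j, g i j * (x i - x j) ^ 2 =
      ∑ i, ∑ j, ((if i < j then g i j * (x i - x j) ^ 2 else 0)
        + (if j < i then g i j * (x i - x j) ^ 2 else 0)) := by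
      refine Finset.sum_congr rfl fun i _ => Finset.sum_congr rfl fun j _ => ?_
      rcases lt_trichotomy i j with h | h | h
      · simp [h, h.le]
      · simp [h]
      · simp [h, h.le]
    rw [this]
    simp only [Finset.sum_add_distrib]
    have h2 : ∑ i, ∑ j, (if j < i then g i j * (x i - x j) ^ 2 else 0) =
        ∑ i, ∑ j, (if i < j then g i j * (x i - x j) ^ 2 else 0) := by
      rw [Finset.sum_comm]
      refine Finset.sum_congr rfl fun i _ => Finset.sum_congr rfl fun j _ => ?_
      rw [hs j i]
      split_ifs
      · ring
      · rfl
    rw [h2, Finset.sum_filter, ← Finset.univ_product_univ, Finset.sum_product]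
    simp only [dif]
    ring
  linarith

lemma dform_zero_const {N : ℕ} (γ : Fin N → Fin N → ℝ) (hpos : ∀ a b, 0 ≤ γ a b)
    (hconn : (edgeGraph (blackE γ)).Connected) (x : Fin N → ℝ) (h : dform γ x x = 0)
    (a b : Fin N) : x a = x b := by
  have hz : ∀ q ∈ blackE γ, x q.1 = x q.2 := by
    intro q hq
    have hnn : ∀ q ∈ blackE γ, 0 ≤ γ q.1 q.2 * dif x q * dif x q := fun q _ => by
      rw [mul_assoc]; exact mul_nonneg (hpos _ _) (mul_self_nonneg _)
    have := (Finset.sum_eq_zero_iff_of_nonneg hnn).1 h q hq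
    have hne := (Finset.mem_filter.1 hq).2.2
    have hd : dif x q = 0 := by
      rcases mul_eq_zero.1 this with h | h
      · exact (mul_eq_zero.1 h).resolve_left hne
      · exact h
    exact sub_eq_zero.1 hd
  obtain ⟨p⟩ := hconn.preconnected a b
  induction p with
  | nil => rfl
  | cons h p ih =>
    rw [← ih]
    simp only [edgeGraph, SimpleGraph.fromRel_adj] at h
    rcases h.2 with h | h
    · exact hz _ h
    · exact (hz _ h).symm

lemma spectral_part {N : ℕ} (A : Matrix (Fin N) (Fin N) ℝ) (hA : A.IsHermitian)
    (hN : Nonempty (Fin N))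
    (h1 : Matrix.mulVec A (fun _ => 1) = 0)
    (hle : ∀ x : Fin N → ℝ, x ⬝ᵥ Matrix.mulVec A x ≤ 0)
    (heq : ∀ x : Fin N → ℝ, x ⬝ᵥ Matrix.mulVec A x = 0 → ∀ a b, x a = x b) :
    negCount A hA = N - 1 ∧ zeroCount A hA = 1 ∧ posCount A hA = 0 := by
  set v : Fin N → Fin N → ℝ := fun i => ⇑(hA.eigenvectorBasis i) with hv
  have hin : ∀ i j, v i ⬝ᵥ v j = if i = j then 1 else 0 := by
    intro i j
    have := orthonormal_iff_ite.1 hA.eigenvectorBasis.orthonormal i j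
    rw [← this]
    simp [v, dotProduct, PiLp.inner_apply, mul_comm]
  have hev : ∀ i, v i ⬝ᵥ Matrix.mulVec A (v i) = hA.eigenvalues i := by
    intro i
    have := hA.mulVec_eigenvectorBasis i
    simp only [v] at hin ⊢
    rw [this, dotProduct_smul, hin]
    simp
  have hnp : ∀ i, hA.eigenvalues i ≤ 0 := fun i => by rw [← hev]; exact hle _
  have hpz : posCount A hA = 0 := by
    unfold posCount
    rw [Finset.card_eq_zero, Finset.filter_eq_empty_iff]
    intro i _
    exact not_lt.2 (hnp i)
  have hex : ∃ i, hA.eigenvalues i = 0 := by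
    have hdet : A.det = 0 := by
      apply Matrix.exists_mulVec_eq_zero_iff.1
      refine ⟨fun _ => 1, ?_, h1⟩
      intro h
      have := congrFun h hN.some
      simp at this
    rw [hA.det_eq_prod_eigenvalues] at hdet
    obtain ⟨i, _, hi⟩ := Finset.prod_eq_zero_iff.1 hdet
    exact ⟨i, by simpa using hi⟩
  obtain ⟨i, hi⟩ := hex
  have huniq : ∀ j, hA.eigenvalues j = 0 → j = i := by
    intro j hj
    by_contra hne
    have ci := heq (v i) (by rw [hev, hi])
    have cj := heq (v j) (by rw [hev, hj])
    have hii := hin i i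
    have hjj := hin j j
    have hji := hin j i
    rw [if_pos rfl] at hii hjj
    rw [if_neg hne] at hji
    obtain ⟨o⟩ := hN
    have hi' : v i = fun _ => v i o := funext fun a => ci a o
    have hj' : v j = fun _ => v j o := funext fun a => cj a o
    rw [hi'] at hii hji
    rw [hj'] at hjj hji
    simp only [dotProduct, Finset.sum_const, nsmul_eq_mul] at hii hjj hji
    have : (1 : ℝ) = 0 := by
      calc (1 : ℝ) = 1 * 1 := by ring
        _ = _ := by nth_rewrite 1 [← hii]; rw [← hjj]
        _ = _ * _ := by rw [mul_mul_mul_comm]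
        _ = ((univ : Finset (Fin N)).card * (v j o * v i o)) *
            ((univ : Finset (Fin N)).card * (v j o * v i o)) := by ring
        _ = 0 := by rw [hji]; ring
    exact one_ne_zero this
  have hzero : (univ.filter fun j => hA.eigenvalues j = 0) = {i} := by
    ext j
    simp only [Finset.mem_filter, Finset.mem_univ, true_and, Finset.mem_singleton]
    exact ⟨huniq j, fun h => by rw [h, hi]⟩
  have hneg : (univ.filter fun j => hA.eigenvalues j < 0) = univ.erase i := by
    ext j
    simp only [Finset.mem_filter, Finset.mem_univ, true_and, Finset.mem_erase, and_true]
    constructor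
    · rintro h rfl
      exact h.ne hi
    · intro h
      exact lt_of_le_of_ne (hnp j) fun h' => h (huniq j h')
  refine ⟨?_, ?_, hpz⟩
  · unfold negCount
    rw [hneg, Finset.card_erase_of_mem (Finset.mem_univ _)]
    simp
  · unfold zeroCount
    rw [hzero, Finset.card_singleton]

/-- **Stability via an ℓ¹ condition.**  Let `Γ₊` be connected with positive
weights `γ` and let `e₁,…,e_R` be additional red edges.  With
`ω_i = treeSum γ / redDenom γ (e i)`, if `t_i ≥ 0` and `Σ t_i < min_i ω_i`,
then the Laplacian of the graph with weights `−t_i` on the red edges has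
spectral index `(n₋, n₀, n₊) = (N−1, 1, 0)`. -/
theorem ell_one_stability
    {N R : ℕ} (γ : Fin N → Fin N → ℝ)
    (hsym : ∀ a b, γ a b = γ b a) (hdiag : ∀ a, γ a a = 0)
    (hpos : ∀ a b, 0 ≤ γ a b)
    (hconn : (edgeGraph (blackE γ)).Connected)
    (e : Fin R → Fin N × Fin N)
    (he : ∀ i, (e i).1 < (e i).2) (hinj : Function.Injective e)
    (hnotblack : ∀ i, γ (e i).1 (e i).2 = 0)
    (t : Fin R → ℝ) (ht : ∀ i, 0 ≤ t i)
    (hbound : ∀ i, (∑ m : Fin R, t m) < treeSum γ / redDenom γ (e i))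
    (γt : Fin N → Fin N → ℝ)
    (hγt : γt = fun a b => γ a b -
      ∑ m ∈ univ.filter (fun m => e m = (a, b) ∨ e m = (b, a)), t m)
    (hH : (lapl γt).IsHermitian) :
    negCount _ hH = N - 1 ∧ zeroCount _ hH = 1 ∧ posCount _ hH = 0 := by
  have hts : ∀ a b, γt a b = γt b a := by
    intro a b
    rw [hγt]
    simp only [hsym a b, or_comm]
  have hSt : 0 ≤ ∑ m, t m := Finset.sum_nonneg fun m _ => ht m
  have hprod : ∀ T, 0 ≤ prodWeight γ T := fun T => Finset.prod_nonneg fun _ _ => hpos _ _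
  have hτ : 0 ≤ treeSum γ := Finset.sum_nonneg fun T _ => hprod T
  have hDnn : ∀ p, 0 ≤ redDenom γ p := fun p => Finset.sum_nonneg fun T _ => hprod _
  have hD : ∀ m, 0 < redDenom γ (e m) := by
    intro m
    refine lt_of_le_of_ne (hDnn _) fun h => ?_
    have := hbound m
    rw [← h, div_zero] at this
    linarith
  have hform : ∀ x : Fin N → ℝ, x ⬝ᵥ Matrix.mulVec (lapl γt) x =
      -(dform γ x x - ∑ m, t m * dif x (e m) ^ 2) := by
    intro x
    rw [lapl_form γt hts x]
    congr 1
    have h1 : dform γ x x = ∑ q ∈ univ.filter (fun q : Fin N × Fin N => q.1 < q.2),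
        γ q.1 q.2 * dif x q ^ 2 := by
      unfold dform blackE
      rw [← Finset.filter_filter, Finset.sum_filter_of_ne]
      · exact Finset.sum_congr rfl fun q _ => by ring
      · intro q _ h h0
        rw [h0] at h
        simp at h
    have h2 : ∑ m, t m * dif x (e m) ^ 2 =
        ∑ q ∈ univ.filter (fun q : Fin N × Fin N => q.1 < q.2),
          ∑ m ∈ univ.filter (fun m => e m = q), t m * dif x (e m) ^ 2 := by
      rw [Finset.sum_fiberwise_of_maps_to]
      intro m _
      simp [he m]
    rw [h1, h2, ← Finset.sum_sub_distrib]
    refine Finset.sum_congr rfl fun q hq => ?_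
    have hq' : q.1 < q.2 := (Finset.mem_filter.1 hq).2
    have h3 : univ.filter (fun m => e m = (q.1, q.2) ∨ e m = (q.2, q.1)) =
        univ.filter (fun m => e m = q) := by
      ext m
      simp only [Finset.mem_filter, Finset.mem_univ, true_and]
      constructor
      · rintro (h | h)
        · exact h
        · have := he m
          rw [h] at this
          exact absurd this (not_lt.2 hq'.le)
      · intro h
        exact Or.inl h
    rw [hγt]
    simp only [h3]
    rw [sub_mul, Finset.sum_mul]
    congr 1
    refine Finset.sum_congr rfl fun m hm => ?_
    rw [(Finset.mem_filter.1 hm).2]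
  have hdnn : ∀ x, 0 ≤ dform γ x x := fun x => Finset.sum_nonneg fun q _ => by
    rw [mul_assoc]; exact mul_nonneg (hpos _ _) (mul_self_nonneg _)
  -- strict bound
  have hstrict : ∀ x, 0 < dform γ x x → ∑ m, t m * dif x (e m) ^ 2 < dform γ x x := by
    intro x hx
    by_cases hR : (∑ m, t m) = 0
    · have : ∀ m, t m = 0 := fun m =>
        (Finset.sum_eq_zero_iff_of_nonneg (fun m _ => ht m)).1 hR m (Finset.mem_univ _)
      simp [this, hx]
    · have hSpos : 0 < ∑ m, t m := lt_of_le_of_ne hSt (Ne.symm hR)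
      have hm : ∀ m, (∑ k, t k) * dif x (e m) ^ 2 < dform γ x x := by
        intro m
        have h1 := resistance γ hpos (e m) (he m) (hnotblack m) (hD m) x
        have h2 := (lt_div_iff₀ (hD m)).1 (hbound m)
        by_cases hd : dif x (e m) ^ 2 = 0
        · rw [hd, mul_zero]; exact hx
        · have hd' : 0 < dif x (e m) ^ 2 := lt_of_le_of_ne (sq_nonneg _) (Ne.symm hd)
          have h3 := mul_lt_mul_of_pos_right h2 hd'
          have h4 : redDenom γ (e m) * ((∑ k, t k) * dif x (e m) ^ 2) <
              redDenom γ (e m) * dform γ x x := by linarith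
          exact lt_of_mul_lt_mul_left h4 (hD m).le
      obtain ⟨m0, -, hm0⟩ : ∃ m ∈ (univ : Finset (Fin R)), t m ≠ 0 := by
        exact Finset.exists_ne_zero_of_sum_ne_zero hR
      have h5 : ∑ m, t m * ((∑ k, t k) * dif x (e m) ^ 2) < ∑ m, t m * dform γ x x := by
        apply Finset.sum_lt_sum
        · intro m _
          exact mul_le_mul_of_nonneg_left (hm m).le (ht m)
        · exact ⟨m0, Finset.mem_univ _,
            mul_lt_mul_of_pos_left (hm m0) (lt_of_le_of_ne (ht m0) (Ne.symm hm0))⟩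
      rw [← Finset.sum_mul] at h5
      have h6 : ∑ m, t m * ((∑ k, t k) * dif x (e m) ^ 2) =
          (∑ k, t k) * ∑ m, t m * dif x (e m) ^ 2 := by
        rw [Finset.mul_sum]
        exact Finset.sum_congr rfl fun m _ => by ring
      rw [h6] at h5
      exact lt_of_mul_lt_mul_left h5 hSpos.le
  have hzero : ∀ x, dform γ x x = 0 → ∑ m, t m * dif x (e m) ^ 2 = 0 := by
    intro x hx
    refine Finset.sum_eq_zero fun m _ => ?_
    have : dif x (e m) = 0 := sub_eq_zero.2 (dform_zero_const γ hpos hconn x hx _ _)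
    rw [this]
    ring
  apply spectral_part _ hH hconn.nonempty
  · ext i
    simp only [Matrix.mulVec, dotProduct, mul_one, lapl, Matrix.of_apply, Pi.zero_apply]
    rw [← Finset.add_sum_erase _ _ (Finset.mem_univ i), if_pos rfl, Finset.filter_ne']
    have hc : ∑ k ∈ univ.erase i, (if i = k then -∑ k ∈ univ.erase i, γt i k else γt i k) =
        ∑ k ∈ univ.erase i, γt i k :=
      Finset.sum_congr rfl fun k hk => if_neg (Finset.ne_of_mem_erase hk).symm
    rw [hc]
    ring
  · intro x
    rw [hform]
    rcases (hdnn x).eq_or_lt with h | h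
    · rw [hzero x h.symm, ← h]; simp
    · linarith [hstrict x h]
  · intro x hx
    rw [hform] at hx
    rcases (hdnn x).eq_or_lt with h | h
    · exact dform_zero_const γ hpos hconn x h.symm
    · linarith [hstrict x h]
end
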